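/- (Poisson transform of a constant form.) Let n ≥ 2, 0 ≤ p ≤ n and a < 1. For every constant form ω ∈ Λ^p ℂ^{n−1} ⊂ Λ^p ℂ^n (not involving e_n) and every x = (x', x_n) ∈ ℝ^n with x_n ≠ 0 one has ∫_{ℝ^{n−1}} |x_n|^{1−a} (|x' − y|² + x_n²)^{−(n−a+2)/2} (i_{x−y} ε_{x−y} − ε_{x−y} i_{x−y}) ω dy = [π^{(n−1)/2} (n − 2p − a) Γ((1−a)/2) / (2 Γ((n−a+2)/2))] · ω, where y ∈ ℝ^{n−1} is viewed as (y,0) ∈ ℝ^n. In particular, if additionally 2 − n + 2p < a and 0 ≤ p ≤ n/2, then P_{a,p} ω(x) = ω for all x with x_n ≠ 0. -/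

import Mathlib

open MeasureTheory Complex Finset

noncomputable section

/-- Euclidean space ℝ^n -/
abbrev Rn (n : ℕ) := EuclideanSpace ℝ (Fin n)

/-- The full exterior algebra Λ^•ℂ^n, realized as the Euclidean space with orthonormal
basis indexed by subsets of {1,…,n} (the basis e_S = e_{i_1}∧…∧e_{i_p}). -/
abbrev Lam (n : ℕ) := EuclideanSpace ℂ (Finset (Fin n))

variable {n : ℕ}

/-- the sign (-1)^{#{i ∈ S : i < j}} -/
def wsign (j : Fin n) (S : Finset (Fin n)) : ℂ := (-1) ^ (S.filter (· < j)).card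

/-- exterior multiplication ε_x by x ∈ ℂ^n -/
def eps (x : Fin n → ℂ) (v : Lam n) : Lam n :=
  WithLp.toLp 2 fun S => ∑ j ∈ S, wsign j S * x j * v (S.erase j)

/-- interior multiplication i_x by x ∈ ℂ^n (adjoint of ε_x for real x) -/
def iot (x : Fin n → ℂ) (v : Lam n) : Lam n :=
  WithLp.toLp 2 fun S => ∑ j ∈ Sᶜ, wsign j S * x j * v (insert j S)

/-- v lies in the degree-p part Λ^p ℂ^n ⊆ Λ^• ℂ^n -/
def IsForm (p : ℕ) (v : Lam n) : Prop := ∀ S, S.card ≠ p → v S = 0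

/-- complexification of a real vector -/
def rc (x : Fin n → ℝ) : Fin n → ℂ := fun j => (x j : ℂ)

/-- the j-th standard basis vector of ℂ^n -/
def ee (j : Fin n) : Fin n → ℂ := fun i => if i = j then 1 else 0

/-- extend x' ∈ ℝ^{n-1} by last coordinate t to the vector (x',t) ∈ ℝ^n -/
def app (x' : Rn (n-1)) (t : ℝ) : Rn n :=
  WithLp.toLp 2 fun j => if h : (j : ℕ) < n - 1 then x' ⟨j, h⟩ else t

/-- restriction ℝ^n → ℝ^{n-1}, x ↦ x' -/
def restr (ξ : Rn n) : Rn (n-1) := WithLp.toLp 2 fun i => ξ (Fin.castLE (Nat.sub_le n 1) i)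

/-- the embedding Fin (n-1) ↪ Fin n -/
def embF : Fin (n-1) ↪ Fin n := ⟨Fin.castLE (Nat.sub_le n 1), (Fin.castLE_injective _)⟩

/-- pullback Λ^• ℂ^n → Λ^• ℂ^{n-1}; on p-forms this is the projection i_{e_n} ε_{e_n}
followed by restriction of indices. -/
def projL (v : Lam n) : Lam (n-1) := WithLp.toLp 2 fun T => v (T.map embF)

/-- the inclusion Λ^• ℂ^{n-1} ⊆ Λ^• ℂ^n -/
def incL (v : Lam (n-1)) : Lam n :=
  WithLp.toLp 2 fun S => ∑ T : Finset (Fin (n-1)), if T.map embF = S then v T else 0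

/-- the operator i_z ε_z - ε_z i_z -/
def cmm (z : Fin n → ℂ) (v : Lam n) : Lam n := iot z (eps z v) - eps z (iot z v)

/-- partial derivative ∂/∂x_j -/
def pd (j : Fin n) (u : Rn n → Lam n) : Rn n → Lam n :=
  fun x => fderiv ℝ u x (EuclideanSpace.single j 1)

/-- the differential operator Δ_{a,p} = x_n²Δ + a x_n ∂_n + 2x_n(i_{e_n}d' - ε_{e_n}δ')
- (n-2p) ε_{e_n} i_{e_n}; here ℓ is the index of the last coordinate. -/
def Dap (a : ℝ) (p : ℕ) (ℓ : Fin n) (u : Rn n → Lam n) (x : Rn n) : Lam n :=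
  ((x ℓ)^2 : ℝ) • (∑ j, pd j (pd j u) x)
  + (a * x ℓ) • pd ℓ u x
  + (2 * x ℓ) • (iot (ee ℓ) (∑ j ∈ univ.erase ℓ, eps (ee j) (pd j u x))
      - eps (ee ℓ) (-(∑ j ∈ univ.erase ℓ, iot (ee j) (pd j u x))))
  - ((n : ℝ) - 2*p) • eps (ee ℓ) (iot (ee ℓ) (u x))

/-- the formal transpose of Δ_{a,p} with respect to the bilinear pairing
∫ ⟨u(x), φ(x)⟩ dx (⟨·,·⟩ the bilinear form with ⟨e_S, e_T⟩ = δ_{ST}):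
Δ_{a,p}ᵗφ = Δ(x_n²φ) - a ∂_n(x_n φ) - 2x_n Σ_j (i_{e_j}ε_{e_n} + ε_{e_j}i_{e_n}) ∂_j φ
- (n-2p) ε_{e_n} i_{e_n} φ. -/
def DapT (a : ℝ) (p : ℕ) (ℓ : Fin n) (φ : Rn n → Lam n) (x : Rn n) : Lam n :=
  (∑ j, pd j (pd j (fun y => ((y ℓ)^2 : ℝ) • φ y)) x)
  - a • pd ℓ (fun y => (y ℓ) • φ y) x
  - (2 * x ℓ) • (∑ j ∈ univ.erase ℓ,
      (iot (ee j) (eps (ee ℓ) (pd j φ x)) + eps (ee j) (iot (ee ℓ) (pd j φ x))))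
  - ((n : ℝ) - 2*p) • eps (ee ℓ) (iot (ee ℓ) (φ x))

/-- the Fourier transform with the convention û(ξ) = (2π)^{-n/2} ∫ e^{-i x·ξ} u(x) dx -/
def ft (u : Rn n → Lam n) : Rn n → Lam n := fun ξ =>
  ((2 * Real.pi) ^ (-(n:ℝ)/2) : ℝ) •
    ∫ x, Complex.exp (-(((∑ j, x j * ξ j : ℝ) : ℂ) * Complex.I)) • u x

/-- the inverse Fourier transform -/
def ftInv (u : Rn n → Lam n) : Rn n → Lam n := fun ξ =>
  ((2 * Real.pi) ^ (-(n:ℝ)/2) : ℝ) •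
    ∫ x, Complex.exp ((((∑ j, x j * ξ j : ℝ) : ℂ) * Complex.I)) • u x

/-- The homogeneous Sobolev space Ḣ^{s,p}(ℝ^n) of Λ^pℂ^n-valued tempered distributions,
modeled on the Fourier transform side: an element of the set is the function g = û. -/
def Hdot (n : ℕ) (s : ℝ) (p : ℕ) : Set (Rn n → Lam n) :=
  {g | AEStronglyMeasurable g volume ∧ (∀ ξ, IsForm p (g ξ)) ∧
    Integrable (fun ξ => ‖ξ‖ ^ (2*s) * ‖g ξ‖^2)}

/-- squared weighted L² norm ∫ ‖ξ‖^t ‖g(ξ)‖² dξ on the Fourier side;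
wInt (2s) g is the squared homogeneous Sobolev norm of degree s of u with û = g. -/
def wInt (t : ℝ) (g : Rn n → Lam n) : ℝ := ∫ ξ, ‖ξ‖ ^ t * ‖g ξ‖^2

/-- the operator (c - λ) i_x ε_x + (c + λ) ε_x i_x on Λ^•ℂ^n -/
def opC (c lam : ℝ) (x : Fin n → ℝ) (v : Lam n) : Lam n :=
  ((c - lam : ℝ) : ℂ) • iot (rc x) (eps (rc x) v)
    + ((c + lam : ℝ) : ℂ) • eps (rc x) (iot (rc x) v)

/-- the conformally invariant squared norm ‖u‖_λ² on the Fourier side (for û = g);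
c is dim/2 - p, i.e. n/2 - p on ℝ^n and (n-1)/2 - p on ℝ^{n-1}. -/
def cSq (c lam : ℝ) (g : Rn n → Lam n) : ℝ :=
  ∫ ξ, ‖ξ‖ ^ (-(2*lam)) * (inner ℂ (g ξ) (opC c lam (‖ξ‖⁻¹ • ξ).ofLp (g ξ)) : ℂ).re

/-- the conformally invariant inner product on the Fourier side -/
def cIp (c lam : ℝ) (g h : Rn n → Lam n) : ℂ :=
  ∫ ξ, (‖ξ‖ ^ (-(2*lam)) : ℝ) • (inner ℂ (g ξ) (opC c lam (‖ξ‖⁻¹ • ξ).ofLp (h ξ)) : ℂ)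

/-- the bilinear pairing on Λ^•ℂ^n with ⟨e_S, e_T⟩ = δ_{ST} -/
def blin (v w : Lam n) : ℂ := ∑ S, v S * w S

/-- the pairing ⟨u, ψ⟩ of the tempered distribution u whose Fourier transform is g
with a Schwartz function ψ: ⟨u, ψ⟩ = ⟨û, 𝓕⁻¹ψ⟩ = ∫ ⟨g(ξ), (𝓕⁻¹ψ)(ξ)⟩ dξ. -/
def dpair (g : Rn n → Lam n) (ψ : Rn n → Lam n) : ℂ :=
  ∫ ξ, blin (g ξ) (ftInv ψ ξ)

/-- "Δ_{a,p} u = μ u in the sense of tempered distributions", expressed for the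
distribution u whose Fourier transform is g: testing against all Λ^•ℂ^n-valued
Schwartz functions φ via the formal transpose of Δ_{a,p}. -/
def WeakEig (a : ℝ) (p : ℕ) (ℓ : Fin n) (g : Rn n → Lam n) (μ : ℂ) : Prop :=
  ∀ φ : SchwartzMap (Rn n) (Lam n),
    dpair g (fun x => DapT a p ℓ (fun y => φ y) x - μ • φ x) = 0

/-- the Fourier side of the trace map u ↦ u|_{ℝ^{n-1}}:
(Ru)^(ξ') = (2π)^{-1/2} ∫_ℝ û(ξ', ξ_n) dξ_n, composed with the pullback
Λ^pℂ^n → Λ^pℂ^{n-1}. -/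
def ftrace (g : Rn n → Lam n) : Rn (n-1) → Lam (n-1) := fun ξ' =>
  ((2 * Real.pi) ^ (-(1:ℝ)/2) : ℝ) • ∫ t : ℝ, projL (g (app ξ' t))

/-- the constant c_{a,p} -/
def cP (n p : ℕ) (a : ℝ) : ℝ :=
  2 * Real.Gamma (((n:ℝ) - a + 2)/2) /
    (Real.pi ^ (((n:ℝ)-1)/2) * ((n:ℝ) - 2*p - a) * Real.Gamma ((1-a)/2))

/-- the Poisson transform P_{a,p}f(x) = c_{a,p} ∫_{ℝ^{n-1}} |x_n|^{1-a}
(|x'-y|²+x_n²)^{-(n-a+2)/2} (i_{x-y}ε_{x-y} - ε_{x-y}i_{x-y}) f(y) dy,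
where ℓ is the index of the last coordinate. -/
def Pois (a : ℝ) (p : ℕ) (ℓ : Fin n) (f : Rn (n-1) → Lam (n-1)) (x : Rn n) : Lam n :=
  cP n p a • ∫ y : Rn (n-1),
    (|x ℓ| ^ (1-a) * ‖x - app y 0‖ ^ (-((n:ℝ) - a + 2))) •
      cmm (rc (x - app y 0).ofLp) (incL (f y))

/-- "G is the Fourier transform of the (polynomially bounded, locally integrable)
function u in the sense of tempered distributions":
∫ ⟨G(ξ), ψ(ξ)⟩ dξ = ∫ ⟨u(x), ψ̂(x)⟩ dx for every Schwartz function ψ. -/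
def IsFTof (G : Rn n → Lam n) (u : Rn n → Lam n) : Prop :=
  ∀ ψ : SchwartzMap (Rn n) (Lam n),
    ∫ ξ, blin (G ξ) (ψ ξ) = ∫ x, blin (u x) (ft (fun y => ψ y) x)

lemma radial_int (d : ℕ) (s t : ℝ) (ht : t ≠ 0) (hs : (d:ℝ)/2 < s) :
    Integrable (fun u : EuclideanSpace ℝ (Fin d) => (‖u‖^2 + t^2) ^ (-s)) ∧
    ∫ u : EuclideanSpace ℝ (Fin d), (‖u‖^2 + t^2) ^ (-s)
      = Real.pi ^ ((d:ℝ)/2) * Real.Gamma (s - d/2) / Real.Gamma s * (t^2) ^ ((d:ℝ)/2 - s) := by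
  have ht2 : 0 < t^2 := by positivity
  have hd : (0:ℝ) ≤ (d:ℝ)/2 := by positivity
  have hs0 : 0 < s := by linarith
  have hG : 0 < Real.Gamma s := Real.Gamma_pos_of_pos hs0
  have hG' : 0 < Real.Gamma (s - d/2) := Real.Gamma_pos_of_pos (by linarith)
  let f : ℝ → EuclideanSpace ℝ (Fin d) → ℝ :=
    fun τ u => τ ^ (s-1) * Real.exp (-((‖u‖^2+t^2) * τ))
  have hfe : ∀ τ u, f τ u = τ^(s-1) * Real.exp (-(t^2*τ)) * Real.exp (-τ * ‖u‖^2) := by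
    intro τ u
    simp only [f]
    rw [mul_assoc, ← Real.exp_add]; congr 2; ring
  have hgi : ∀ τ : ℝ, 0 < τ → ∫ u : EuclideanSpace ℝ (Fin d), Real.exp (-τ * ‖u‖^2)
      = (Real.pi/τ) ^ ((d:ℝ)/2) := by
    intro τ hτ
    rw [GaussianFourier.integral_rexp_neg_mul_sq_norm hτ]; simp
  have hin : ∀ τ : ℝ, 0 < τ → ∫ u, f τ u
      = Real.pi ^ ((d:ℝ)/2) * (τ ^ ((s - d/2) - 1) * Real.exp (-(t^2*τ))) := by
    intro τ hτ
    simp_rw [hfe, integral_const_mul, hgi τ hτ]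
    rw [Real.div_rpow Real.pi_pos.le hτ.le, show s - d/2 - 1 = (s-1) - d/2 by ring,
      Real.rpow_sub hτ (s-1) (d/2)]
    ring
  have hout := Real.integral_rpow_mul_exp_neg_mul_Ioi (a := s - d/2) (r := t^2) (by linarith) ht2
  have houti : IntegrableOn (fun x : ℝ ↦ x ^ ((s - d/2) - 1) * Real.exp (-(t^2 * x))) (Set.Ioi 0) :=
    .of_integral_ne_zero (by rw [hout]; positivity)
  have hprod : Integrable (Function.uncurry f) ((volume.restrict (Set.Ioi 0)).prod volume) := by
    rw [integrable_prod_iff]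
    · constructor
      · filter_upwards [ae_restrict_mem measurableSet_Ioi] with τ hτ
        refine Integrable.of_integral_ne_zero ?_
        have := hin τ hτ
        simp only [Function.uncurry]
        rw [this]
        have hτ' : 0 < τ := hτ
        positivity
      · refine (houti.const_mul (Real.pi ^ ((d:ℝ)/2))).congr ?_
        filter_upwards [ae_restrict_mem measurableSet_Ioi] with τ hτ
        have hτ' : 0 < τ := hτ
        rw [← hin τ hτ]
        refine integral_congr_ae (Filter.Eventually.of_forall fun u => ?_)
        simp only [Function.uncurry]
        rw [Real.norm_of_nonneg]
        simp only [f]; positivity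
    · apply Measurable.aestronglyMeasurable
      simp only [f, Function.uncurry_def]
      fun_prop
  have hinu : ∀ u : EuclideanSpace ℝ (Fin d), ∫ τ in Set.Ioi 0, f τ u
      = Real.Gamma s * (‖u‖^2+t^2) ^ (-s) := by
    intro u
    have hp : 0 < ‖u‖^2+t^2 := by positivity
    simp only [f]
    rw [Real.integral_rpow_mul_exp_neg_mul_Ioi hs0 hp, one_div, Real.inv_rpow hp.le,
      Real.rpow_neg hp.le]
    ring
  constructor
  · have h := hprod.integral_prod_right
    simp only [Function.uncurry, hinu] at h
    refine (h.const_mul (Real.Gamma s)⁻¹).congr (Filter.Eventually.of_forall fun u => ?_)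
    simp only
    field_simp
  · have h := integral_integral_swap hprod
    simp only [hinu] at h
    rw [setIntegral_congr_fun measurableSet_Ioi (fun τ hτ => hin τ hτ), integral_const_mul,
      integral_const_mul, hout, one_div, Real.inv_rpow ht2.le, ← Real.rpow_neg ht2.le,
      neg_sub] at h
    rw [div_mul_eq_mul_div, eq_div_iff hG.ne']
    linarith
section moments
variable {d : ℕ} (w : ℝ → ℝ)

lemma int_map_isom (e : EuclideanSpace ℝ (Fin d) ≃ₗᵢ[ℝ] EuclideanSpace ℝ (Fin d))
    (F : EuclideanSpace ℝ (Fin d) → ℝ) : ∫ u, F (e u) = ∫ u, F u :=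
  e.measurePreserving.integral_comp e.toHomeomorph.measurableEmbedding F

/-- flip the sign of coordinate `i` -/
def flipC (i : Fin d) : EuclideanSpace ℝ (Fin d) ≃ₗᵢ[ℝ] EuclideanSpace ℝ (Fin d) :=
  LinearIsometryEquiv.piLpCongrRight 2
    (fun k => if k = i then LinearIsometryEquiv.neg ℝ else LinearIsometryEquiv.refl ℝ ℝ)

lemma flipC_same (i : Fin d) (u) : flipC i u i = - u i := by
  simp [flipC, LinearIsometryEquiv.piLpCongrRight_apply]

lemma flipC_ne (i k : Fin d) (h : k ≠ i) (u) : flipC i u k = u k := by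
  simp [flipC, LinearIsometryEquiv.piLpCongrRight_apply, h]

lemma odd_int (i : Fin d) (F : EuclideanSpace ℝ (Fin d) → ℝ) (h : ∀ u, F (flipC i u) = - F u) :
    ∫ u, F u = 0 := by
  have := int_map_isom (flipC i) F
  simp only [h, integral_neg] at this
  linarith

lemma int_cross (i j : Fin d) (h : i ≠ j) :
    ∫ u : EuclideanSpace ℝ (Fin d), w ‖u‖ * (u i * u j) = 0 := by
  apply odd_int i
  intro u
  rw [LinearIsometryEquiv.norm_map, flipC_same, flipC_ne i j h.symm]; ring

lemma int_lin (i : Fin d) :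
    ∫ u : EuclideanSpace ℝ (Fin d), w ‖u‖ * u i = 0 := by
  apply odd_int i
  intro u
  rw [LinearIsometryEquiv.norm_map, flipC_same]; ring

lemma int_sq_eq (i j : Fin d) :
    ∫ u : EuclideanSpace ℝ (Fin d), w ‖u‖ * (u i * u i) =
    ∫ u : EuclideanSpace ℝ (Fin d), w ‖u‖ * (u j * u j) := by
  rw [← int_map_isom (LinearIsometryEquiv.piLpCongrLeft 2 ℝ ℝ (Equiv.swap i j))]
  refine integral_congr_ae (Filter.Eventually.of_forall fun u => ?_)
  simp [LinearIsometryEquiv.piLpCongrLeft_apply,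
    Equiv.piCongrLeft']

lemma int_sq (i : Fin d)
    (hi : ∀ j : Fin d, Integrable (fun u : EuclideanSpace ℝ (Fin d) => w ‖u‖ * (u j * u j))) :
    d * ∫ u : EuclideanSpace ℝ (Fin d), w ‖u‖ * (u i * u i) =
    ∫ u : EuclideanSpace ℝ (Fin d), w ‖u‖ * ‖u‖^2 := by
  have : ∀ u : EuclideanSpace ℝ (Fin d), w ‖u‖ * ‖u‖^2 = ∑ j, w ‖u‖ * (u j * u j) := by
    intro u
    rw [EuclideanSpace.real_norm_sq_eq, Finset.mul_sum]
    simp only [sq]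
  simp_rw [this]
  rw [integral_finsetSum _ (fun j _ => hi j)]
  rw [Finset.sum_congr rfl (fun j _ => int_sq_eq w j i)]
  simp
end moments
lemma app_normsq (u : Rn (n-1)) (t : ℝ) (hn : 2 ≤ n) :
    ‖(app u t : Rn n)‖^2 = ‖u‖^2 + t^2 := by
  obtain ⟨m, rfl⟩ : ∃ m, n = m + 1 := ⟨n-1, by omega⟩
  rw [EuclideanSpace.real_norm_sq_eq, EuclideanSpace.real_norm_sq_eq, Fin.sum_univ_castSucc]
  simp [app]

/-- the basic constant -/
def MM (n : ℕ) (a : ℝ) : ℝ :=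
  Real.pi ^ (((n:ℝ)-1)/2) * Real.Gamma ((1-a)/2) / (2 * Real.Gamma (((n:ℝ) - a + 2)/2))

lemma abs_coord_le (z : Rn n) (j : Fin n) : |z j| ≤ ‖z‖ := by
  simpa using PiLp.norm_apply_le z j

lemma moment (hn : 2 ≤ n) (a : ℝ) (ha : a < 1) (t : ℝ) (ht : t ≠ 0)
    (ℓ : Fin n) (hℓ : (ℓ : ℕ) = n - 1) (j k : Fin n) :
    Integrable (fun u : Rn (n-1) => |t| ^ (1-a) * ‖(app u t : Rn n)‖ ^ (-((n:ℝ) - a + 2)) *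
      ((app u t : Rn n) j * (app u t : Rn n) k)) ∧
    ∫ u : Rn (n-1), |t| ^ (1-a) * ‖(app u t : Rn n)‖ ^ (-((n:ℝ) - a + 2)) *
      ((app u t : Rn n) j * (app u t : Rn n) k)
      = if j = k then (if j = ℓ then (1-a) * MM n a else MM n a) else 0 := by
  have hn2 : (2:ℝ) ≤ n := by exact_mod_cast hn
  have hdn : ((n-1 : ℕ) : ℝ) = n - 1 := by push_cast [Nat.cast_sub (show 1 ≤ n by omega)]; ring
  obtain ⟨s, hs⟩ : ∃ s, s = ((n:ℝ) - a + 2)/2 := ⟨_, rfl⟩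
  have ht2 : 0 < t^2 := by positivity
  have hpos : ∀ u : Rn (n-1), 0 < ‖u‖^2 + t^2 := fun u => by positivity
  let w : ℝ → ℝ := fun r => |t| ^ (1-a) * (r^2 + t^2) ^ (-s)
  have hw : ∀ u : Rn (n-1), |t| ^ (1-a) * ‖(app u t : Rn n)‖ ^ (-((n:ℝ) - a + 2)) = w ‖u‖ := by
    intro u
    simp only [w]
    rw [← app_normsq u t hn, ← Real.rpow_natCast, ← Real.rpow_mul (norm_nonneg _)]
    congr 2
    rw [hs]; push_cast; ring
  simp_rw [hw]
  obtain ⟨i0, e0⟩ := radial_int (n-1) s t ht (by rw [hdn, hs]; linarith)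
  obtain ⟨i1, e1⟩ := radial_int (n-1) (s-1) t ht (by rw [hdn, hs]; linarith)
  have hw1 : ∀ u : Rn (n-1), w ‖u‖ * (‖u‖^2+t^2)
      = |t| ^ (1-a) * (‖u‖^2 + t^2) ^ (-(s-1)) := by
    intro u
    simp only [w]
    rw [show -(s-1) = -s + 1 by ring, Real.rpow_add (hpos u), Real.rpow_one]; ring
  have hI : Integrable (fun u : Rn (n-1) => w ‖u‖ * (‖u‖^2+t^2)) := by
    simp_rw [hw1]; exact i1.const_mul _
  have hwpos : ∀ u : Rn (n-1), 0 ≤ w ‖u‖ := fun u => by simp only [w]; positivity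
  have happm : ∀ i : Fin n, Measurable (fun u : Rn (n-1) => (app u t : Rn n) i) := by
    intro i
    by_cases h : (i:ℕ) < n - 1
    · simp only [app, h, dif_pos]; fun_prop
    · simp only [app, h]; simp
  have hint : ∀ j k : Fin n, Integrable (fun u : Rn (n-1) => w ‖u‖ *
      ((app u t : Rn n) j * (app u t : Rn n) k)) := by
    intro j k
    refine hI.mono' ?_ (Filter.Eventually.of_forall fun u => ?_)
    · have h1 := happm j
      have h2 := happm k
      apply Measurable.aestronglyMeasurable
      simp only [w]
      fun_prop
    · rw [norm_mul, Real.norm_of_nonneg (hwpos u), ← app_normsq u t hn, norm_mul, sq]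
      exact mul_le_mul_of_nonneg_left (mul_le_mul (abs_coord_le _ _) (abs_coord_le _ _)
        (abs_nonneg _) (norm_nonneg _)) (hwpos u)
  refine ⟨hint j k, ?_⟩
  have happl : ∀ u : Rn (n-1), (app u t : Rn n) ℓ = t := by
    intro u; simp [app, hℓ]
  have happi : ∀ (i : Fin n), i ≠ ℓ → ∃ i' : Fin (n-1), (i':ℕ) = i ∧
      ∀ u : Rn (n-1), (app u t : Rn n) i = u i' := by
    intro i hi
    have : (i:ℕ) < n - 1 := by
      have := i.2
      have : (i:ℕ) ≠ ℓ := fun h => hi (Fin.ext h)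
      omega
    exact ⟨⟨i, this⟩, rfl, fun u => by simp [app, this]⟩
  have hG1 : 0 < Real.Gamma ((1-a)/2) := Real.Gamma_pos_of_pos (by linarith)
  have hG2 : 0 < Real.Gamma (s-1) := Real.Gamma_pos_of_pos (by linarith)
  have hG3 : Real.Gamma s = (s-1) * Real.Gamma (s-1) := by
    have := Real.Gamma_add_one (s := s-1) (by linarith)
    rwa [sub_add_cancel] at this
  have hG4 : Real.Gamma (s - (n-1)/2) = (1-a)/2 * Real.Gamma ((1-a)/2) := by
    rw [← Real.Gamma_add_one (by linarith)]; congr 1; rw [hs]; ring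
  have hs1 : 0 < s - 1 := by linarith
  have htt : ∀ b : ℝ, (t^2)^b = |t|^(2*b) := by
    intro b
    rw [← sq_abs, ← Real.rpow_natCast, ← Real.rpow_mul (abs_nonneg _)]; norm_num
  have habs : 0 < |t| := abs_pos.mpr ht
  -- total mass times t^2
  have hA : ∫ u : Rn (n-1), w ‖u‖ * (t * t) = (1-a) * MM n a := by
    simp only [w]
    rw [integral_mul_const, integral_const_mul, e0, hdn, hG4, htt]
    have : |t|^(1-a) * |t| ^ (2 * (((n:ℝ)-1)/2 - s)) * (t*t) = 1 := by
      rw [← abs_mul_abs_self t, ← sq, ← Real.rpow_natCast, ← Real.rpow_add habs,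
        ← Real.rpow_add habs]
      rw [hs]; convert Real.rpow_zero |t| using 2; push_cast; ring
    rw [MM, ← hs]
    linear_combination (Real.pi ^ (((n:ℝ)-1)/2) * ((1-a)/2 * Real.Gamma ((1-a)/2)) / Real.Gamma s) * this
  have hB : ∫ u : Rn (n-1), w ‖u‖ * (‖u‖^2 + t^2) = 2 * (s-1) * MM n a := by
    simp_rw [hw1]
    rw [integral_const_mul, e1, hdn, htt]
    have : |t|^(1-a) * |t| ^ (2 * (((n:ℝ)-1)/2 - (s-1))) = 1 := by
      rw [← Real.rpow_add habs]
      rw [hs]; convert Real.rpow_zero |t| using 2; ring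
    rw [MM, ← hs, hG3, show s - 1 - ((n:ℝ)-1)/2 = (1-a)/2 by rw [hs]; ring]
    have e : 2 * (s-1) * (Real.pi ^ (((n:ℝ)-1)/2) * Real.Gamma ((1-a)/2) /
        (2 * ((s-1) * Real.Gamma (s-1)))) = Real.pi ^ (((n:ℝ)-1)/2) * Real.Gamma ((1-a)/2) / Real.Gamma (s-1) := by
      field_simp
    rw [e]
    linear_combination (Real.pi ^ (((n:ℝ)-1)/2) * Real.Gamma ((1-a)/2) / Real.Gamma (s-1)) * this
  by_cases hjk : j = k
  · subst hjk
    rw [if_pos rfl]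
    by_cases hj : j = ℓ
    · subst hj
      simp only [happl, if_true]
      exact hA
    · rw [if_neg hj]
      obtain ⟨j', -, hj'⟩ := happi j hj
      simp only [hj']
      have h1 : ∀ i : Fin (n-1), Integrable (fun u : Rn (n-1) => w ‖u‖ * (u i * u i)) := by
        intro i
        have := hint (Fin.castLE (Nat.sub_le n 1) i) (Fin.castLE (Nat.sub_le n 1) i)
        simpa [app] using this
      have h2 := int_sq w j' h1
      have h3 : ∫ u : Rn (n-1), w ‖u‖ * ‖u‖^2 = 2 * (s-1) * MM n a - (1-a) * MM n a := by
        rw [← hA, ← hB, ← integral_sub hI]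
        · congr 1; ext u; ring
        · have := hint ℓ ℓ
          simpa only [happl] using this
      rw [h3, hdn] at h2
      have hne : (n:ℝ) - 1 ≠ 0 := by linarith
      apply mul_left_cancel₀ hne
      rw [h2, hs]; ring
  · rw [if_neg hjk]
    by_cases hj : j = ℓ
    · obtain ⟨k', -, hk'⟩ := happi k (fun h => hjk (hj.trans h.symm))
      subst hj
      simp only [hk', happl]
      have := int_lin w k'
      simp_rw [mul_left_comm _ t, integral_const_mul, this, mul_zero]
    · obtain ⟨j', hj1, hj'⟩ := happi j hj
      by_cases hk : k = ℓ
      · subst hk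
        simp only [hj', happl]
        have := int_lin w j'
        simp_rw [← mul_assoc, integral_mul_const, this, zero_mul]
      · obtain ⟨k', hk1, hk'⟩ := happi k hk
        simp only [hj', hk']
        apply int_cross
        intro h
        exact hjk (Fin.ext (by rw [← hj1, ← hk1, h]))
lemma wsign_sq (j : Fin n) (S : Finset (Fin n)) : wsign j S * wsign j S = 1 := by
  rw [wsign, ← mul_pow]; simp

lemma wsign_insert (j : Fin n) (S : Finset (Fin n)) : wsign j (insert j S) = wsign j S := by
  simp [wsign, Finset.filter_insert]

lemma wsign_erase (j : Fin n) (S : Finset (Fin n)) : wsign j (S.erase j) = wsign j S := by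
  rw [wsign, wsign, Finset.filter_erase, Finset.erase_eq_of_notMem (by simp)]

lemma cmm_apply (z : Fin n → ℂ) (v : Lam n) (S : Finset (Fin n)) :
    cmm z v S = (∑ j ∈ Sᶜ, ∑ k ∈ insert j S,
        (wsign j S * wsign k (insert j S) * v ((insert j S).erase k)) * (z j * z k))
      - ∑ j ∈ S, ∑ k ∈ (S.erase j)ᶜ,
        (wsign j S * wsign k (S.erase j) * v (insert k (S.erase j))) * (z j * z k) := by
  simp only [cmm, iot, eps, PiLp.sub_apply, Finset.mul_sum]
  congr 1
  · refine Finset.sum_congr rfl fun j _ => Finset.sum_congr rfl fun k _ => ?_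
    ring
  · refine Finset.sum_congr rfl fun j _ => Finset.sum_congr rfl fun k _ => ?_
    ring

lemma sub_app (hn : 2 ≤ n) (ℓ : Fin n) (hℓ : (ℓ : ℕ) = n - 1) (x : Rn n) (y : Rn (n-1)) :
    x - app y 0 = app (restr x - y) (x ℓ) := by
  ext j
  by_cases h : (j:ℕ) < n - 1
  · simp [app, restr, h]
  · have : j = ℓ := Fin.ext (by have := j.2; omega)
    subst this
    simp [app, h]

lemma incL_projL (hn : 2 ≤ n) (ℓ : Fin n) (hℓ : (ℓ : ℕ) = n - 1) (ω : Lam n)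
    (hω' : ∀ S : Finset (Fin n), ℓ ∈ S → ω S = 0) : incL (projL ω) = ω := by
  ext S
  simp only [incL, projL]
  by_cases hS : ℓ ∈ S
  · rw [hω' S hS]
    refine Finset.sum_eq_zero fun T _ => ?_
    split_ifs with h
    · rw [h, hω' S hS]
    · rfl
  · obtain ⟨T0, hT0⟩ : ∃ T0 : Finset (Fin (n-1)), T0.map embF = S := by
      refine ⟨Finset.univ.filter (fun i => embF i ∈ S), ?_⟩
      ext j
      simp only [Finset.mem_map, Finset.mem_filter, Finset.mem_univ, true_and]
      constructor
      · rintro ⟨i, hi, rfl⟩; exact hi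
      · intro hj
        have : (j:ℕ) < n - 1 := by
          have := j.2
          have : (j:ℕ) ≠ ℓ := fun h => hS (by rwa [← Fin.ext h])
          omega
        exact ⟨⟨j, this⟩, hj, rfl⟩
    rw [Finset.sum_eq_single T0]
    · simp [hT0]
    · intro T _ hT
      rw [if_neg]
      intro h
      exact hT (Finset.map_injective embF (h.trans hT0.symm))
    · simp

lemma const_int (hn : 2 ≤ n) (p : ℕ)
    (a : ℝ) (ha : a < 1)
    (ℓ : Fin n) (hℓ : (ℓ : ℕ) = n - 1)
    (ω : Lam n) (hω : IsForm p ω) (hω' : ∀ S : Finset (Fin n), ℓ ∈ S → ω S = 0)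
    (t : ℝ) (ht : t ≠ 0) :
    (∫ u : Rn (n-1),
        (|t| ^ (1-a) * ‖(app u t : Rn n)‖ ^ (-((n:ℝ) - a + 2))) • cmm (rc (app u t : Rn n).ofLp) ω)
      = (((n:ℝ) - 2*p - a) * MM n a) • ω := by
  set q : Fin n → Fin n → Rn (n-1) → ℝ := fun j k u =>
    |t| ^ (1-a) * ‖(app u t : Rn n)‖ ^ (-((n:ℝ) - a + 2)) *
      ((app u t : Rn n) j * (app u t : Rn n) k) with hq
  have hm := moment hn a ha t ht ℓ hℓ
  have hqi : ∀ j k (c : ℂ), Integrable (fun u => c * (q j k u : ℂ)) := fun j k c =>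
    ((hm j k).1.ofReal).const_mul c
  have hqe : ∀ j k, ∫ u, (q j k u : ℂ)
      = ((if j = k then (if j = ℓ then (1-a) * MM n a else MM n a) else 0 : ℝ) : ℂ) := by
    intro j k
    rw [← (hm j k).2]
    exact integral_ofReal
  have hcomp : ∀ (S : Finset (Fin n)) (u : Rn (n-1)),
      ((|t| ^ (1-a) * ‖(app u t : Rn n)‖ ^ (-((n:ℝ) - a + 2))) •
        cmm (rc (app u t : Rn n).ofLp) ω) S =
      (∑ j ∈ Sᶜ, ∑ k ∈ insert j S,
        (wsign j S * wsign k (insert j S) * ω ((insert j S).erase k)) * (q j k u : ℂ))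
      - ∑ j ∈ S, ∑ k ∈ (S.erase j)ᶜ,
        (wsign j S * wsign k (S.erase j) * ω (insert k (S.erase j))) * (q j k u : ℂ) := by
    intro S u
    rw [PiLp.smul_apply, cmm_apply, Complex.real_smul, mul_sub, Finset.mul_sum, Finset.mul_sum]
    simp only [Finset.mul_sum, hq, rc, Complex.ofReal_mul]
    congr 1
    · refine Finset.sum_congr rfl fun j _ => Finset.sum_congr rfl fun k _ => ?_
      ring
    · refine Finset.sum_congr rfl fun j _ => Finset.sum_congr rfl fun k _ => ?_
      ring
  have hi1 : ∀ S : Finset (Fin n), Integrable (fun u => ∑ j ∈ Sᶜ, ∑ k ∈ insert j S,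
        (wsign j S * wsign k (insert j S) * ω ((insert j S).erase k)) * (q j k u : ℂ)) := fun S =>
    integrable_finsetSum _ fun j _ => integrable_finsetSum _ fun k _ => hqi j k _
  have hi2 : ∀ S : Finset (Fin n), Integrable (fun u => ∑ j ∈ S, ∑ k ∈ (S.erase j)ᶜ,
        (wsign j S * wsign k (S.erase j) * ω (insert k (S.erase j))) * (q j k u : ℂ)) := fun S =>
    integrable_finsetSum _ fun j _ => integrable_finsetSum _ fun k _ => hqi j k _
  ext S
  rw [eval_integral_piLp (fun S => by simp only [hcomp]; exact (hi1 S).sub (hi2 S))]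
  simp only [hcomp]
  rw [integral_sub (hi1 S) (hi2 S),
    integral_finsetSum _ (fun j _ => integrable_finsetSum _ fun k _ => hqi j k _),
    integral_finsetSum _ (fun j _ => integrable_finsetSum _ fun k _ => hqi j k _)]
  set m : Fin n → ℂ := fun j => ((if j = ℓ then (1-a) * MM n a else MM n a : ℝ) : ℂ) with hmdef
  have E1 : ∀ j ∈ Sᶜ, ∫ u, ∑ k ∈ insert j S,
        (wsign j S * wsign k (insert j S) * ω ((insert j S).erase k)) * (q j k u : ℂ)
        = m j * ω S := by
    intro j hj
    have hj' : j ∉ S := by simpa using hj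
    rw [integral_finsetSum _ (fun k _ => hqi j k _)]
    simp_rw [integral_const_mul, hqe]
    rw [Finset.sum_eq_single j]
    · rw [if_pos rfl, wsign_insert, wsign_sq, Finset.erase_insert hj']; ring
    · intro k _ hk
      rw [if_neg hk.symm]; simp
    · simp
  have E2 : ∀ j ∈ S, ∫ u, ∑ k ∈ (S.erase j)ᶜ,
        (wsign j S * wsign k (S.erase j) * ω (insert k (S.erase j))) * (q j k u : ℂ)
        = m j * ω S := by
    intro j hj
    rw [integral_finsetSum _ (fun k _ => hqi j k _)]
    simp_rw [integral_const_mul, hqe]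
    rw [Finset.sum_eq_single j]
    · rw [if_pos rfl, wsign_erase, wsign_sq, Finset.insert_erase hj]; ring
    · intro k _ hk
      rw [if_neg hk.symm]; simp
    · simp
  rw [Finset.sum_congr rfl E1, Finset.sum_congr rfl E2, ← Finset.sum_mul, ← Finset.sum_mul,
    PiLp.smul_apply, Complex.real_smul]
  by_cases h0 : ω S = 0
  · simp [h0]
  have hSp : S.card = p := by
    by_contra h; exact h0 (hω S h)
  have hSℓ : ℓ ∉ S := fun h => h0 (hω' S h)
  have hs2 : ∑ j ∈ S, m j = p * (MM n a : ℂ) := by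
    rw [Finset.sum_congr rfl (g := fun _ => (MM n a : ℂ)), Finset.sum_const, hSp, nsmul_eq_mul]
    intro j hj
    have : j ≠ ℓ := fun h => hSℓ (h ▸ hj)
    simp [hmdef, this]
  have hs3 : ∑ j, m j = ((1-a) + (n-1)) * (MM n a : ℂ) := by
    rw [← Finset.add_sum_erase _ _ (Finset.mem_univ ℓ),
      Finset.sum_congr rfl (g := fun _ => (MM n a : ℂ)), Finset.sum_const,
      Finset.card_erase_of_mem (Finset.mem_univ _), nsmul_eq_mul]
    · simp only [hmdef, Finset.card_univ, Fintype.card_fin]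
      rw [Nat.cast_sub (by omega)]
      simp; ring
    · intro j hj
      have : j ≠ ℓ := (Finset.mem_erase.mp hj).1
      simp [hmdef, this]
  have hs1 := Finset.sum_compl_add_sum S m
  rw [← sub_mul]
  congr 1
  push_cast
  linear_combination hs1 + hs3 - 2 * hs2

/-- Poisson transform of a constant form. For a constant form
ω ∈ Λ^p ℂ^{n-1} ⊂ Λ^p ℂ^n (not involving e_n) and x_n ≠ 0:
∫_{ℝ^{n-1}} |x_n|^{1-a} (|x'-y|²+x_n²)^{-(n-a+2)/2} (i_{x-y}ε_{x-y} - ε_{x-y}i_{x-y}) ω dy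
  = [π^{(n-1)/2} (n-2p-a) Γ((1-a)/2) / (2 Γ((n-a+2)/2))] ω,
and if moreover 2-n+2p < a and p ≤ n/2 then P_{a,p} ω (x) = ω. -/
theorem stmt12 (n p : ℕ) (hn : 2 ≤ n) (hp : p ≤ n)
    (a : ℝ) (ha : a < 1)
    (ℓ : Fin n) (hℓ : (ℓ : ℕ) = n - 1)
    (ω : Lam n) (hω : IsForm p ω) (hω' : ∀ S : Finset (Fin n), ℓ ∈ S → ω S = 0)
    (x : Rn n) (hx : x ℓ ≠ 0) :
    (∫ y : Rn (n-1),
        (|x ℓ| ^ (1-a) * ‖x - app y 0‖ ^ (-((n:ℝ) - a + 2))) • cmm (rc (x - app y 0).ofLp) ω)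
      = ((Real.pi ^ (((n:ℝ)-1)/2) * ((n:ℝ) - 2*p - a) * Real.Gamma ((1-a)/2) /
          (2 * Real.Gamma (((n:ℝ) - a + 2)/2))) : ℝ) • ω ∧
    (2 - (n:ℝ) + 2*p < a → 2*p ≤ n →
      Pois a p ℓ (fun _ : Rn (n-1) => projL ω) x = ω) := by
  have hI : (∫ y : Rn (n-1),
        (|x ℓ| ^ (1-a) * ‖x - app y 0‖ ^ (-((n:ℝ) - a + 2))) • cmm (rc (x - app y 0).ofLp) ω)
      = ((Real.pi ^ (((n:ℝ)-1)/2) * ((n:ℝ) - 2*p - a) * Real.Gamma ((1-a)/2) /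
          (2 * Real.Gamma (((n:ℝ) - a + 2)/2))) : ℝ) • ω := by
    simp_rw [sub_app hn ℓ hℓ x]
    rw [integral_sub_left_eq_self (fun u : Rn (n-1) =>
      (|x ℓ| ^ (1-a) * ‖(app u (x ℓ) : Rn n)‖ ^ (-((n:ℝ) - a + 2))) •
        cmm (rc (app u (x ℓ) : Rn n).ofLp) ω) volume (restr x),
      const_int hn p a ha ℓ hℓ ω hω hω' (x ℓ) hx]
    congr 1
    rw [MM]; ring
  refine ⟨hI, fun h1 h2 => ?_⟩
  rw [Pois]
  simp only [incL_projL hn ℓ hℓ ω hω']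
  rw [hI, smul_smul]
  have h3 : 2 * p + 1 ≤ n := by
    rcases Nat.lt_or_ge (2*p) n with h | h
    · exact h
    · have : (2*p : ℝ) = n := by exact_mod_cast le_antisymm h2 h
      linarith
  have h4 : (2:ℝ) * p + 1 ≤ n := by exact_mod_cast h3
  have hpos : 0 < (n:ℝ) - 2*p - a := by linarith
  have hG1 : 0 < Real.Gamma ((1-a)/2) := Real.Gamma_pos_of_pos (by linarith)
  have hG2 : 0 < Real.Gamma (((n:ℝ) - a + 2)/2) :=
    Real.Gamma_pos_of_pos (by have : (0:ℝ) ≤ n := by positivity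
                              linarith)
  have hpi : 0 < Real.pi ^ (((n:ℝ)-1)/2) := Real.rpow_pos_of_pos Real.pi_pos _
  have : cP n p a * (Real.pi ^ (((n:ℝ)-1)/2) * ((n:ℝ) - 2*p - a) * Real.Gamma ((1-a)/2) /
          (2 * Real.Gamma (((n:ℝ) - a + 2)/2))) = 1 := by
    rw [cP, div_mul_div_comm, div_eq_one_iff_eq (by positivity)]
    ring
  rw [this, one_smul]
end
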